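/- Let A be a finite left brace such that Aⁿ = 0 for some n. Then A is the direct sum of left braces whose cardinalities are powers of prime numbers (namely the Sylow subgroups of the additive group of A). In particular, the adjoint group A° of A is a nilpotent group. -/

import Mathlib

namespace Paper

/-- A left brace: an abelian group `(A,+)` with a multiplication `bmul` that is left
distributive over addition and such that the circle operation
`a ∘ b = a·b + a + b` makes `A` into a group (the adjoint group) with identity `0`. -/
class LeftBrace (A : Type*) extends AddCommGroup A where
  bmul : A → A → A
  bmul_add : ∀ a b c : A, bmul a (b + c) = bmul a b + bmul a c
  circ_assoc : ∀ a b c : A,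
    bmul (bmul a b + a + b) c + (bmul a b + a + b) + c
      = bmul a (bmul b c + b + c) + a + (bmul b c + b + c)
  zero_circ : ∀ a : A, bmul 0 a + 0 + a = a
  circ_zero : ∀ a : A, bmul a 0 + a + 0 = a
  exists_circ_inv : ∀ a : A, ∃ b : A, bmul a b + a + b = 0 ∧ bmul b a + b + a = 0

namespace LeftBrace

variable {A : Type*} [LeftBrace A]

/-- The circle operation `a ∘ b = a·b + a + b` of a left brace. -/
def circ (a b : A) : A := bmul a b + a + b

/-- The adjoint group `A°` of a left brace: the group `(A, ∘)`. -/
noncomputable def adjointGroup (A : Type*) [LeftBrace A] : Group A where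
  mul := circ
  one := (0 : A)
  inv a := Classical.choose (exists_circ_inv a)
  mul_assoc := circ_assoc
  one_mul := zero_circ
  mul_one := circ_zero
  inv_mul_cancel a := (Classical.choose_spec (exists_circ_inv a)).2

/-- The adjoint group `A°` of the left brace `A` is a nilpotent group. -/
def AdjointNilpotent (A : Type*) [LeftBrace A] : Prop :=
  @Group.IsNilpotent A (adjointGroup A)

/-- For subsets `C, D ⊆ A`, `C · D` is the set of all finite sums `Σ cᵢ·dᵢ`
with `cᵢ ∈ C`, `dᵢ ∈ D`, i.e. the additive submonoid generated by the products. -/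
def setMulSub (C D : Set A) : AddSubmonoid A :=
  AddSubmonoid.closure {x : A | ∃ c ∈ C, ∃ d ∈ D, x = bmul c d}

/-- `C · D` as a set. -/
def setMul (C D : Set A) : Set A := (setMulSub C D : Set A)

/-- `pow A n = Aⁿ` for `n ≥ 1`: `A¹ = A`, `A^{n+1} = A · Aⁿ`.  (`pow A 0` is set to `A`.) -/
def pow (A : Type*) [LeftBrace A] : ℕ → Set A
  | 0 => Set.univ
  | 1 => Set.univ
  | (n+2) => setMul Set.univ (pow A (n+1))

/-- `rpow A n = A^{(n)}` for `n ≥ 1`: `A^{(1)} = A`, `A^{(n+1)} = A^{(n)} · A`.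
(`rpow A 0` is set to `A`.) -/
def rpow (A : Type*) [LeftBrace A] : ℕ → Set A
  | 0 => Set.univ
  | 1 => Set.univ
  | (n+2) => setMul (rpow A (n+1)) Set.univ

/-- `brk A n = A^{[n]}` for `n ≥ 1`: `A^{[1]} = A`,
`A^{[n+1]} = Σ_{i=1}^{n} A^{[i]} · A^{[n+1-i]}`.  (`brk A 0` is set to `A`.) -/
def brk (A : Type*) [LeftBrace A] : ℕ → Set A
  | 0 => Set.univ
  | 1 => Set.univ
  | (n+2) =>
    (((Finset.range (n+1)).attach.sup
      (fun i => setMulSub (brk A (i.1 + 1)) (brk A (n + 1 - i.1)))) : AddSubmonoid A)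
  decreasing_by
  · have h := i.2; simp only [Finset.mem_range] at h; omega
  · omega


/-- The product of a family of left braces, with componentwise operations. -/
noncomputable def piBrace {ι : Type*} (B : ι → Type*) (instB : ∀ i, LeftBrace (B i)) :
    LeftBrace (∀ i, B i) :=
  letI : ∀ i, LeftBrace (B i) := instB
  { (inferInstance : AddCommGroup (∀ i, B i)) with
    bmul := fun f g i => bmul (f i) (g i)
    bmul_add := fun a b c => funext fun i => bmul_add (a i) (b i) (c i)
    circ_assoc := fun a b c => funext fun i => circ_assoc (a i) (b i) (c i)
    zero_circ := fun a => funext fun i => zero_circ (a i)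
    circ_zero := fun a => funext fun i => circ_zero (a i)
    exists_circ_inv := fun a =>
      ⟨fun i => Classical.choose (exists_circ_inv (a i)),
        funext fun i => (Classical.choose_spec (exists_circ_inv (a i))).1,
        funext fun i => (Classical.choose_spec (exists_circ_inv (a i))).2⟩ }

/-- An isomorphism of left braces: an additive isomorphism preserving the brace
multiplication. -/
structure BraceIso (A B : Type*) [LeftBrace A] [LeftBrace B] extends A ≃+ B where
  map_bmul : ∀ a b : A, toAddEquiv (bmul a b) = bmul (toAddEquiv a) (toAddEquiv b)

/-- `A` is the direct sum of (finitely many) left braces whose cardinalities are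
powers of prime numbers. -/
def IsPrimePowerDirectSum (A : Type*) [LeftBrace A] : Prop :=
  ∃ (k : ℕ) (B : Fin k → Type) (instB : ∀ i, LeftBrace (B i)),
    (∀ i, ∃ p m : ℕ, p.Prime ∧ Nat.card (B i) = p ^ m) ∧
    Nonempty (@BraceIso A (∀ i, B i) _ (piBrace B instB))

theorem bmul_zero (a : A) : bmul a 0 = 0 := by
  simpa using bmul_add a 0 0

/-- Left multiplication by `a` as an additive endomorphism. -/
def bmulHom (a : A) : A →+ A where
  toFun := bmul a
  map_zero' := bmul_zero a
  map_add' := bmul_add a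

@[simp]
theorem bmulHom_apply (a b : A) : bmulHom a b = bmul a b := rfl

theorem bmul_circ (a b c : A) :
    bmul (circ a b) c = bmul a (bmul b c) + bmul a c + bmul b c := by
  have h := circ_assoc a b c
  simp only [bmul_add] at h
  simp only [circ]
  have key : bmul (bmul a b + a + b) c + (bmul a b + a + b + c)
      = bmul a (bmul b c) + bmul a c + bmul b c + (bmul a b + a + b + c) := by
    rw [← add_assoc, h]
    abel
  exact add_right_cancel key

theorem bmul_circ_add (a b c : A) :
    bmul (circ a b) c + c = bmul a (bmul b c + c) + (bmul b c + c) := by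
  rw [bmul_circ, bmul_add]
  abel

theorem bmul_add_left_of_bmul_eq_zero {a b : A} (h : bmul a b = 0) (c : A) :
    bmul (a + b) c = bmul a (bmul b c) + bmul a c + bmul b c := by
  simpa [circ, h] using bmul_circ a b c

theorem iterate_bmul_mem_pow (a c : A) (k : ℕ) : (bmul a)^[k] c ∈ pow A (k + 1) := by
  induction k with
  | zero => exact Set.mem_univ _
  | succ k ih =>
    rw [Function.iterate_succ_apply']
    exact AddSubmonoid.subset_closure ⟨a, Set.mem_univ _, _, ih, rfl⟩

/-- The underlying type of the adjoint group of a left brace. -/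
def Adjoint (A : Type*) : Type _ := A

noncomputable instance : Group (Adjoint A) := adjointGroup A

/-- The action of the adjoint group on the additive group, sending `a` to `b ↦ a·b + b`. -/
def lambdaHom (A : Type*) [LeftBrace A] : Adjoint A →* AddMonoid.End A where
  toFun a := bmulHom (A := A) a + AddMonoidHom.id A
  map_one' := by
    ext c
    simpa only [add_zero] using! zero_circ (A := A) c
  map_mul' a b := AddMonoidHom.ext (bmul_circ_add (A := A) a b)

theorem lambdaHom_apply (a c : A) : lambdaHom A a c = bmul a c + c := rfl

theorem lambdaHom_pow_apply_of_bmul_bmul_eq_zero {a c : A} (h : bmul a (bmul a c) = 0) (m : ℕ) :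
    (lambdaHom A a ^ m) c = c + m • bmul a c := by
  induction m with
  | zero => simp
  | succ m ih =>
    rw [pow_succ', AddMonoid.End.coe_mul, Function.comp_apply, ih, map_add, map_nsmul,
      lambdaHom_apply, lambdaHom_apply, h, zero_add, succ_nsmul]
    abel

theorem bmul_eq_zero_of_coprime {a c : A} {M m k : ℕ} (hMm : M.Coprime m)
    (ha : lambdaHom A a ^ M = 1) (hc : m • c = 0) (hk : (bmul a)^[k] c = 0) :
    bmul a c = 0 := by
  have hm {c : A} (hc : m • c = 0) : m • bmul a c = 0 := by
    rw [← bmulHom_apply, ← map_nsmul, hc, map_zero]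
  induction k generalizing c with
  | zero => simp_all [bmul_zero]
  | succ k ih =>
    have h2 : bmul a (bmul a c) = 0 := ih (hm hc) hk
    have hM : M • bmul a c = 0 := by
      simpa [ha] using lambdaHom_pow_apply_of_bmul_bmul_eq_zero h2 M
    have h1 := Nat.dvd_gcd (addOrderOf_dvd_of_nsmul_eq_zero hM)
      (addOrderOf_dvd_of_nsmul_eq_zero (hm hc))
    rw [hMm.gcd_eq_one] at h1
    exact AddMonoid.addOrderOf_eq_one_iff.1 (Nat.dvd_one.1 h1)

/-- A submodule stable under all left multiplications is a left brace. -/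
abbrev ofSubmodule (L : Submodule ℤ A) (hL : ∀ a, ∀ b ∈ L, bmul a b ∈ L) : LeftBrace L where
  bmul a b := ⟨bmul a.1 b.1, hL _ _ b.2⟩
  bmul_add a b c := Subtype.ext (bmul_add a.1 b.1 c.1)
  circ_assoc a b c := Subtype.ext (circ_assoc a.1 b.1 c.1)
  zero_circ a := Subtype.ext (zero_circ a.1)
  circ_zero a := Subtype.ext (circ_zero a.1)
  exists_circ_inv a := by
    obtain ⟨b, hab, hba⟩ := exists_circ_inv a.1
    have hb : b ∈ L := by
      have : b = -(bmul b a.1 + a.1) := by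
        rw [eq_neg_iff_add_eq_zero, ← hba]
        abel
      rw [this]
      exact L.neg_mem (L.add_mem (hL _ _ a.2) a.2)
    exact ⟨⟨b, hb⟩, Subtype.ext hab, Subtype.ext hba⟩

/-- The adjoint group of a stable submodule embeds in the whole adjoint group. -/
def adjointSubtype (L : Submodule ℤ A) (hL : ∀ a, ∀ b ∈ L, bmul a b ∈ L) :
    letI := ofSubmodule L hL
    Adjoint L →* Adjoint A :=
  letI := ofSubmodule L hL
  { toFun := fun a => Subtype.val (p := (· ∈ L)) a
    map_one' := rfl
    map_mul' := fun _ _ => rfl }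

theorem bmul_eq_zero_of_card_coprime {L : Submodule ℤ A} [Finite L]
    (hL : ∀ a, ∀ b ∈ L, bmul a b ∈ L)
    {a c : A} {m k : ℕ} (ha : a ∈ L) (hLm : (Nat.card L).Coprime m) (hc : m • c = 0)
    (hk : (bmul a)^[k] c = 0) : bmul a c = 0 := by
  let _ := ofSubmodule L hL
  refine bmul_eq_zero_of_coprime hLm ?_ hc hk
  let x : Adjoint L := (⟨a, ha⟩ : L)
  have hx : x ^ Nat.card L = 1 := pow_card_eq_one' (G := Adjoint L)
  calc lambdaHom A a ^ Nat.card L = lambdaHom A (adjointSubtype L hL x) ^ Nat.card L := rfl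
    _ = 1 := by rw [← map_pow, ← map_pow, hx, map_one, map_one]

theorem bmul_mem_torsionBy (r : ℤ) (a : A) {b : A} (hb : b ∈ Submodule.torsionBy ℤ A r) :
    bmul a b ∈ Submodule.torsionBy ℤ A r := by
  rw [Submodule.mem_torsionBy_iff] at hb ⊢
  rw [← bmulHom_apply, ← map_zsmul, hb, map_zero]

section DirectSum

variable {ι : Type*} {L : ι → Submodule ℤ A}

theorem sum_bmul_eq_zero (hzero : ∀ i j, i ≠ j → ∀ a ∈ L i, ∀ c ∈ L j, bmul a c = 0)
    (f : ∀ i, L i) {j : ι} {s : Finset ι} (hj : j ∉ s) {c : A} (hc : c ∈ L j) :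
    bmul (∑ i ∈ s, (f i : A)) c = 0 := by
  classical
  induction s using Finset.induction_on with
  | empty => simpa using zero_circ c
  | insert i s hi ih =>
    rw [Finset.mem_insert, not_or] at hj
    have h0 : bmul (f i : A) (∑ i ∈ s, (f i : A)) = 0 := by
      rw [← bmulHom_apply, map_sum]
      refine Finset.sum_eq_zero fun k hk => hzero i k ?_ _ (f i).2 _ (f k).2
      rintro rfl
      exact hi hk
    rw [Finset.sum_insert hi, bmul_add_left_of_bmul_eq_zero h0, ih hj.2, bmul_zero,
      hzero i j (Ne.symm hj.1) _ (f i).2 _ hc, add_zero, add_zero]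

theorem sum_bmul_sum [Fintype ι] (hzero : ∀ i j, i ≠ j → ∀ a ∈ L i, ∀ c ∈ L j, bmul a c = 0)
    (f g : ∀ i, L i) :
    bmul (∑ i, (f i : A)) (∑ i, (g i : A)) = ∑ i, bmul (f i : A) (g i : A) := by
  classical
  rw [← bmulHom_apply, map_sum]
  refine Finset.sum_congr rfl fun j _ => ?_
  have h0 : bmul (f j : A) (∑ i ∈ Finset.univ.erase j, (f i : A)) = 0 := by
    rw [← bmulHom_apply, map_sum]
    exact Finset.sum_eq_zero fun k hk =>
      hzero j k (Finset.ne_of_mem_erase hk).symm _ (f j).2 _ (f k).2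
  rw [bmulHom_apply, ← Finset.add_sum_erase _ _ (Finset.mem_univ j),
    bmul_add_left_of_bmul_eq_zero h0,
    sum_bmul_eq_zero hzero f (Finset.notMem_erase j _) (g j).2, bmul_zero, zero_add, add_zero]

theorem nonempty_braceIso_of_isInternal [Fintype ι] [DecidableEq ι]
    (hL : ∀ i, ∀ a, ∀ b ∈ L i, bmul a b ∈ L i)
    (hint : DirectSum.IsInternal L)
    (hzero : ∀ i j, i ≠ j → ∀ a ∈ L i, ∀ c ∈ L j, bmul a c = 0) :
    Nonempty (@BraceIso A (∀ i, L i) _ (piBrace _ fun i => ofSubmodule (L i) (hL i))) := by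
  let e : (∀ i, L i) ≃+ A :=
    ((DirectSum.linearEquivFunOnFintype ℤ ι fun i => L i).symm.trans
      (LinearEquiv.ofBijective (DirectSum.coeLinearMap L) hint)).toAddEquiv
  have he (f : ∀ i, L i) : e f = ∑ i, (f i : A) := by
    have hf : f = ∑ i, Pi.single i (f i) := (Finset.univ_sum_single f).symm
    conv_lhs => rw [hf, map_sum]
    refine Finset.sum_congr rfl fun i _ => ?_
    change DirectSum.coeLinearMap L
      ((DirectSum.linearEquivFunOnFintype ℤ ι fun i => L i).symm (Pi.single i (f i))) = _
    rw [DirectSum.linearEquivFunOnFintype_symm_single, DirectSum.coeLinearMap_lof]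
  let _ := piBrace _ fun i => ofSubmodule (L i) (hL i)
  refine ⟨{ e.symm with map_bmul := fun a b => ?_ }⟩
  change e.symm (bmul a b) = bmul (e.symm a) (e.symm b)
  rw [AddEquiv.symm_apply_eq, he]
  conv_lhs => rw [← e.apply_symm_apply a, ← e.apply_symm_apply b, he, he, sum_bmul_sum hzero]
  rfl

end DirectSum

theorem card_torsionBy_prime_pow [Finite A] {p : ℕ} (hp : p.Prime) (v : ℕ) :
    ∃ m, Nat.card (Submodule.torsionBy ℤ A ((p ^ v : ℕ) : ℤ)) = p ^ m := by
  have := Fact.mk hp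
  have h : IsPGroup p (Multiplicative (Submodule.torsionBy ℤ A ((p ^ v : ℕ) : ℤ))) := by
    intro x
    refine ⟨v, Multiplicative.toAdd.injective (Subtype.ext ?_)⟩
    have hx := (Submodule.mem_torsionBy_iff _ _).1 x.toAdd.2
    rwa [natCast_zsmul] at hx
  exact IsPGroup.iff_card (G := Multiplicative _) |>.1 h

theorem isInternal_torsionBy_primeFactors [Finite A] :
    DirectSum.IsInternal fun p : (Nat.card A).primeFactors =>
      Submodule.torsionBy ℤ A ((p.1 ^ (Nat.card A).factorization p : ℕ) : ℤ) := by
  refine Submodule.torsionBy_isInternal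
    (q := fun p : ℕ => ((p ^ (Nat.card A).factorization p : ℕ) : ℤ)) ?_ ?_
  · intro p hp q hq hpq
    exact Nat.isCoprime_iff_coprime.2 (Nat.Coprime.pow _ _
      ((Nat.coprime_primes (Nat.prime_of_mem_primeFactors hp)
        (Nat.prime_of_mem_primeFactors hq)).2 hpq))
  · intro x
    rw [← Nat.cast_prod]
    have : ∏ p ∈ (Nat.card A).primeFactors, p ^ (Nat.card A).factorization p = Nat.card A :=
      Nat.prod_factorization_pow_eq_self Nat.card_pos.ne'
    rw [this, natCast_zsmul, card_nsmul_eq_zero']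

theorem adjointNilpotent_of_card_eq_prime_pow {p m : ℕ} (hp : p.Prime) (h : Nat.card A = p ^ m) :
    AdjointNilpotent A := by
  have := Fact.mk hp
  have : Finite (Adjoint A) := Nat.finite_of_card_ne_zero (h.trans_ne (pow_ne_zero _ hp.ne_zero))
  exact (IsPGroup.of_card (G := Adjoint A) h).isNilpotent

/-- An isomorphism of left braces induces an isomorphism of adjoint groups. -/
def BraceIso.adjointEquiv {B : Type*} [LeftBrace B] (e : BraceIso A B) :
    Adjoint A ≃* Adjoint B where
  toFun := e.toAddEquiv.toFun
  invFun := e.toAddEquiv.invFun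
  left_inv := e.toAddEquiv.left_inv
  right_inv := e.toAddEquiv.right_inv
  map_mul' a b := by
    have h (a b : A) : e.toAddEquiv (circ a b) = circ (e.toAddEquiv a) (e.toAddEquiv b) := by
      rw [circ, circ, map_add, map_add, e.map_bmul]
    exact h a b

theorem IsPrimePowerDirectSum.adjointNilpotent (h : IsPrimePowerDirectSum A) :
    AdjointNilpotent A := by
  obtain ⟨k, B, instB, hB, ⟨e⟩⟩ := h
  have (i : Fin k) : Group.IsNilpotent (Adjoint (B i)) := by
    obtain ⟨p, m, hp, hm⟩ := hB i
    exact adjointNilpotent_of_card_eq_prime_pow (A := B i) hp hm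
  let _ := piBrace B instB
  let f : Adjoint (∀ i, B i) ≃* (∀ i, Adjoint (B i)) :=
    { Equiv.refl _ with map_mul' := fun _ _ => rfl }
  exact Group.nilpotent_of_mulEquiv (G' := Adjoint A) (e.adjointEquiv.trans f).symm

/-- Let `A` be a finite left brace with `Aⁿ = 0` for some `n`.  Then
`A` is the direct sum of left braces whose cardinalities are powers of primes, and in
particular the adjoint group `A°` of `A` is a nilpotent group. -/
theorem finite_leftBrace_primePowerDirectSum_of_pow_eq_bot
    (A : Type) [LeftBrace A] [Finite A] (n : ℕ) (hn : 1 ≤ n)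
    (h : pow A n = {0}) :
    IsPrimePowerDirectSum A ∧ AdjointNilpotent A := by
  refine (fun hA : IsPrimePowerDirectSum A => ⟨hA, hA.adjointNilpotent⟩) ?_
  obtain ⟨n, rfl⟩ := Nat.exists_eq_add_of_le' hn
  let S := (Nat.card A).primeFactors
  let σ : Fin S.card ≃ S := S.equivFin.symm
  have hp (i : Fin S.card) : (σ i : ℕ).Prime := Nat.prime_of_mem_primeFactors (σ i).2
  let L (p : S) : Submodule ℤ A :=
    Submodule.torsionBy ℤ A ((p.1 ^ (Nat.card A).factorization p : ℕ) : ℤ)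
  have hL (i : Fin S.card) (a b : A) (hb : b ∈ L (σ i)) : bmul a b ∈ L (σ i) :=
    bmul_mem_torsionBy _ a hb
  have hcard (i : Fin S.card) : ∃ m, Nat.card (L (σ i)) = (σ i : ℕ) ^ m :=
    card_torsionBy_prime_pow (hp i) _
  have hint : DirectSum.IsInternal fun i => L (σ i) := by
    have h := isInternal_torsionBy_primeFactors (A := A)
    rw [DirectSum.isInternal_submodule_iff_iSupIndep_and_iSup_eq_top] at h ⊢
    exact ⟨h.1.comp σ.injective, (σ.iSup_comp (g := L)).trans h.2⟩
  refine ⟨S.card, fun i => L (σ i), fun i => ofSubmodule _ (hL i),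
    fun i => ⟨σ i, (hcard i).choose, hp i, (hcard i).choose_spec⟩,
    nonempty_braceIso_of_isInternal hL hint fun i j hij a ha c hc => ?_⟩
  obtain ⟨m, hm⟩ := hcard i
  refine bmul_eq_zero_of_card_coprime (k := n) (hL i) ha
    (m := (σ j : ℕ) ^ (Nat.card A).factorization (σ j)) ?_ ?_ ?_
  · rw [hm]
    exact Nat.Coprime.pow _ _ ((Nat.coprime_primes (hp i) (hp j)).2
      fun h => hij (σ.injective (Subtype.ext h)))
  · rw [← natCast_zsmul]
    exact (Submodule.mem_torsionBy_iff _ _).1 hc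
  · simpa [h] using iterate_bmul_mem_pow a c n

end LeftBrace

end Paper
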